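/- Fix k ≥ 3. Let Δ_k = (ℤ/kℤ) ⋊_φ ℤ (φ sending 1 to inversion) with generating set T_k = {(i,0) : i ≠ 0} ∪ {(i,1) : i ≠ 0,1} ∪ {(i,-1) : i ≠ 0,1}. Then there is no Baire measurable k-coloring of the shift graph of (Δ_k,T_k); that is, the Baire measurable chromatic number of this shift graph equals k+1. -/

import Mathlib

open Multiplicative

section Defs

variable {G : Type*} [Group G]

/-- The left shift action of `g : G` on `x : G → Bool` (`2^G` with `2 = Bool`):
`(g · x)(h) = x (g⁻¹ h)`. -/
def shiftMap (g : G) (x : G → Bool) : G → Bool := fun h => x (g⁻¹ * h)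

/-- The free part `F(2^G)` of the left shift action. -/
def FreePart (G : Type*) [Group G] : Set (G → Bool) :=
  {x | ∀ g : G, g ≠ 1 → shiftMap g x ≠ x}

/-- Adjacency in the shift graph of the marked group `(G, S)`: distinct `x, y ∈ F(2^G)`
are adjacent iff `y = s · x` for some `s ∈ S`. -/
def ShiftAdj (S : Set G) (x y : FreePart G) : Prop :=
  x ≠ y ∧ ∃ s ∈ S, (y : G → Bool) = shiftMap s (x : G → Bool)

/-- Adjacency in the Cayley graph of `(G, S)`: distinct `g, h` are adjacent iff
`h = s * g` for some `s ∈ S`. -/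
def CayleyAdj (S : Set G) (g h : G) : Prop :=
  g ≠ h ∧ ∃ s ∈ S, h = s * g

/-- `(G, S)` is a marked group: `S` is a finite symmetric generating set
not containing the identity. -/
def IsMarkedGroup (S : Set G) : Prop :=
  S.Finite ∧ (∀ s ∈ S, s⁻¹ ∈ S) ∧ (1 : G) ∉ S ∧ Subgroup.closure S = ⊤

end Defs

/-- A graph (given by its adjacency relation) has an `n`-coloring. -/
def HasColoring {X : Type*} (Adj : X → X → Prop) (n : ℕ) : Prop :=
  ∃ c : X → Fin n, ∀ x y, Adj x y → c x ≠ c y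

/-- The chromatic number: the least `n` admitting an `n`-coloring. -/
noncomputable def chromatic {X : Type*} (Adj : X → X → Prop) : ℕ :=
  sInf {n | HasColoring Adj n}

/-- A graph on a measurable space has a Borel `n`-coloring. -/
def HasBorelColoring {X : Type*} [MeasurableSpace X] (Adj : X → X → Prop) (n : ℕ) : Prop :=
  ∃ c : X → Fin n, Measurable c ∧ ∀ x y, Adj x y → c x ≠ c y

/-- The Borel chromatic number: the least `n` admitting a Borel `n`-coloring. -/
noncomputable def borelChromatic {X : Type*} [MeasurableSpace X] (Adj : X → X → Prop) : ℕ :=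
  sInf {n | HasBorelColoring Adj n}
/-- A graph on a topological space has a Baire measurable `n`-coloring: a coloring all
of whose color classes have the Baire property. -/
def HasBaireColoring {X : Type*} [TopologicalSpace X] (Adj : X → X → Prop) (n : ℕ) :
    Prop :=
  ∃ c : X → Fin n, (∀ i : Fin n, BaireMeasurableSet (c ⁻¹' {i})) ∧
    ∀ x y, Adj x y → c x ≠ c y

/-- The Baire measurable chromatic number. -/
noncomputable def baireChromatic {X : Type*} [TopologicalSpace X]
    (Adj : X → X → Prop) : ℕ :=
  sInf {n | HasBaireColoring Adj n}

/-- The homomorphism `ℤ → Aut(ℤ/kℤ)` (written multiplicatively) sending `1` to the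
inversion automorphism `i ↦ -i`. -/
def phiK (k : ℕ) : Multiplicative ℤ →* MulAut (Multiplicative (ZMod k)) :=
  zpowersHom (MulAut (Multiplicative (ZMod k))) (MulEquiv.inv (Multiplicative (ZMod k)))

/-- The marked group `Δ_k = ℤ/kℤ ⋊_φ ℤ`, `φ` sending `1` to inversion. -/
abbrev DeltaK (k : ℕ) : Type :=
  SemidirectProduct (Multiplicative (ZMod k)) (Multiplicative ℤ) (phiK k)

/-- The generating set
`T_k = {(i,0) : i ≠ 0} ∪ {(i,1) : i ≠ 0,1} ∪ {(i,-1) : i ≠ 0,1}` of `Δ_k`. -/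
def TK (k : ℕ) : Set (DeltaK k) :=
  {x | ∃ i : ZMod k, i ≠ 0 ∧ x = ⟨ofAdd i, ofAdd (0 : ℤ)⟩} ∪
  {x | ∃ i : ZMod k, i ≠ 0 ∧ i ≠ 1 ∧ x = ⟨ofAdd i, ofAdd (1 : ℤ)⟩} ∪
  {x | ∃ i : ZMod k, i ≠ 0 ∧ i ≠ 1 ∧ x = ⟨ofAdd i, ofAdd (-1 : ℤ)⟩}


section General

variable {G : Type*} [Group G]

theorem shiftMap_shiftMap (g h : G) (x : G → Bool) :
    shiftMap g (shiftMap h x) = shiftMap (g * h) x := by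
  funext t; simp [shiftMap, mul_assoc]

theorem shiftMap_one' (x : G → Bool) : shiftMap 1 x = x := by
  funext t; simp [shiftMap]

theorem shiftMap_mem_free (g : G) {x : G → Bool} (hx : x ∈ FreePart G) :
    shiftMap g x ∈ FreePart G := by
  intro h hh he
  apply hx (g⁻¹ * h * g)
  · intro h1
    apply hh
    have : h = g * (g⁻¹ * h * g) * g⁻¹ := by group
    rw [this, h1]; group
  · have := congrArg (shiftMap g⁻¹) he
    rw [shiftMap_shiftMap, shiftMap_shiftMap, shiftMap_shiftMap] at this
    rw [this]; simp [shiftMap_one']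

theorem continuous_shiftMap (g : G) : Continuous (shiftMap g : (G → Bool) → G → Bool) :=
  continuous_pi fun h => continuous_apply (g⁻¹ * h)

/-- The action of `G` on the free part. -/
def act (g : G) (x : FreePart G) : FreePart G := ⟨shiftMap g x, shiftMap_mem_free g x.2⟩

theorem act_act (g h : G) (x : FreePart G) : act g (act h x) = act (g * h) x :=
  Subtype.ext (shiftMap_shiftMap g h x)

theorem act_one (x : FreePart G) : act 1 x = x :=
  Subtype.ext (shiftMap_one' _)

theorem act_inj {g h : G} {x : FreePart G} (e : act g x = act h x) : g = h := by
  by_contra hne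
  have h1 : act (h⁻¹ * g) x = x := by
    rw [← act_act, e, act_act]; simp [act_one]
  refine x.2 (h⁻¹ * g) ?_ (congrArg Subtype.val h1)
  intro h2
  exact hne (inv_mul_eq_one.mp h2).symm

theorem continuous_act (g : G) : Continuous (act g : FreePart G → FreePart G) :=
  ((continuous_shiftMap g).comp continuous_subtype_val).subtype_mk _

/-- The action as a homeomorphism. -/
def actHomeo (g : G) : FreePart G ≃ₜ FreePart G where
  toFun := act g
  invFun := act g⁻¹
  left_inv x := by rw [act_act]; simp [act_one]
  right_inv x := by rw [act_act]; simp [act_one]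
  continuous_toFun := continuous_act g
  continuous_invFun := continuous_act g⁻¹

theorem shiftAdj_iff (S : Set G) (x y : FreePart G) :
    ShiftAdj S x y ↔ x ≠ y ∧ ∃ s ∈ S, y = act s x := by
  unfold ShiftAdj
  refine and_congr_right fun _ => exists_congr fun s => and_congr_right fun _ => ?_
  exact ⟨fun h => Subtype.ext h, fun h => congrArg Subtype.val h⟩

theorem isOpen_moved (g : G) : IsOpen {x : G → Bool | shiftMap g x ≠ x} :=
  isOpen_ne_fun (continuous_shiftMap g) continuous_id

theorem open_nhd_pi {V : Set (G → Bool)} (hV : IsOpen V) {x : G → Bool} (hx : x ∈ V) :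
    ∃ D : Finset G, ∀ y : G → Bool, (∀ d ∈ D, y d = x d) → y ∈ V := by
  obtain ⟨I, u, h1, h2⟩ := isOpen_pi_iff.mp hV x hx
  refine ⟨I, fun y hy => h2 fun a ha => ?_⟩
  rw [hy a ha]; exact (h1 a ha).2

theorem dense_moved [Infinite G] (g : G) (hg : g ≠ 1) :
    Dense {x : G → Bool | shiftMap g x ≠ x} := by
  classical
  rw [dense_iff_inter_open]
  rintro V hV ⟨x, hx⟩
  obtain ⟨D, hD⟩ := open_nhd_pi hV hx
  obtain ⟨h, hh⟩ := Infinite.exists_notMem_finset D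
  by_cases hc : shiftMap g x = x
  · refine ⟨Function.update x h (!(x h)), hD _ fun d hd => ?_, fun he => ?_⟩
    · rw [Function.update_of_ne]; rintro rfl; exact hh hd
    · have h1 := congrFun he h
      have h2 := congrFun hc h
      simp only [shiftMap] at h1 h2
      rw [Function.update_of_ne, Function.update_self, h2] at h1
      · simp at h1
      · intro h3; apply hg; simpa using h3
  · exact ⟨x, hx, hc⟩

theorem freePart_eq : FreePart G = ⋂ g : {g : G // g ≠ 1}, {x : G → Bool | shiftMap g.1 x ≠ x} := by
  ext x; simp [FreePart]

theorem dense_freePart [Countable G] [Infinite G] : Dense (FreePart G) := by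
  rw [freePart_eq]
  exact dense_iInter_of_isOpen (fun g => isOpen_moved g.1) (fun g => dense_moved g.1 g.2)

theorem baire_freePart [Countable G] [Infinite G] : BaireSpace (FreePart G) := by
  refine IsGδ.baireSpace_of_dense ?_ dense_freePart
  rw [freePart_eq]
  exact IsGδ.iInter_of_isOpen fun g => isOpen_moved g.1

theorem exists_free_agree [Countable G] [Infinite G] (D : Finset G) (p : G → Bool) :
    ∃ y : FreePart G, ∀ d ∈ D, y.1 d = p d := by
  have ho : IsOpen ((D : Set G).pi fun d => ({p d} : Set Bool)) :=
    isOpen_set_pi D.finite_toSet fun a _ => isOpen_discrete _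
  obtain ⟨y, hy, hy'⟩ := dense_freePart.inter_open_nonempty _ ho ⟨p, fun a _ => rfl⟩
  exact ⟨⟨y, hy'⟩, fun d hd => hy d hd⟩

theorem open_nhd_free {V : Set (FreePart G)} (hV : IsOpen V) {x : FreePart G} (hx : x ∈ V) :
    ∃ D : Finset G, ∀ y : FreePart G, (∀ d ∈ D, y.1 d = x.1 d) → y ∈ V := by
  obtain ⟨W, hW, rfl⟩ := isOpen_induced_iff.mp hV
  obtain ⟨D, hD⟩ := open_nhd_pi hW hx
  exact ⟨D, fun y hy => hD _ hy⟩

end General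

section Delta

variable {k : ℕ}

/-- The sign `(-1)^n` in `ZMod k`. -/
def sg (k : ℕ) (n : ℤ) : ZMod k := (((-1 : (ZMod k)ˣ) ^ n : (ZMod k)ˣ) : ZMod k)

theorem sg_zero : sg k 0 = 1 := by simp [sg]
theorem sg_one : sg k 1 = -1 := by simp [sg]
theorem sg_add (n m : ℤ) : sg k (n + m) = sg k n * sg k m := by simp [sg, zpow_add]
theorem sg_neg (n : ℤ) : sg k (-n) = sg k n := by
  simp only [sg, zpow_neg, ← inv_zpow, inv_neg, inv_one]
theorem sg_mul_self (n : ℤ) : sg k n * sg k n = 1 := by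
  nth_rewrite 1 [← sg_neg n]
  rw [← sg_add, neg_add_cancel, sg_zero]
theorem sg_sub (n m : ℤ) : sg k (n - m) = sg k n * sg k m := by
  rw [sub_eq_add_neg, sg_add, sg_neg]
theorem sg_succ (n : ℤ) : sg k (n + 1) = - sg k n := by
  rw [sg_add, sg_one]; ring

theorem phiK_apply (n : ℤ) (a : ZMod k) :
    phiK k (ofAdd n) (ofAdd a) = ofAdd (sg k n * a) := by
  have key : ∀ n : ℤ, ∀ a : ZMod k,
      ((MulEquiv.inv (Multiplicative (ZMod k)) : MulAut (Multiplicative (ZMod k))) ^ n) (ofAdd a)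
        = ofAdd (sg k n * a) := by
    intro n
    induction n using Int.induction_on with
    | zero => intro a; simp [sg_zero]
    | succ i ih =>
      intro a
      rw [zpow_add_one, MulAut.mul_apply, MulEquiv.inv_apply, ← ofAdd_neg, ih, sg_succ]
      congr 1; ring
    | pred i ih =>
      intro a
      rw [zpow_sub_one, MulAut.mul_apply]
      have : ((MulEquiv.inv (Multiplicative (ZMod k)) : MulAut (Multiplicative (ZMod k)))⁻¹)
          (ofAdd a) = ofAdd (-a) := by
        rfl
      rw [this, ih, sg_sub, sg_one]
      congr 1; ring
  exact key n a

/-- The element `(a, n)` of `Δ_k`. -/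
def el (a : ZMod k) (n : ℤ) : DeltaK k := ⟨ofAdd a, ofAdd n⟩

theorem el_mul (a b : ZMod k) (n m : ℤ) : el a n * el b m = el (a + sg k n * b) (n + m) := by
  apply SemidirectProduct.ext
  · rw [SemidirectProduct.mul_left]
    change ofAdd a * phiK k (ofAdd n) (ofAdd b) = _
    rw [phiK_apply]; rfl
  · rfl

theorem el_one : (el 0 0 : DeltaK k) = 1 := rfl

theorem el_inv (a : ZMod k) (n : ℤ) : (el a n)⁻¹ = el (-(sg k n * a)) (-n) := by
  rw [inv_eq_iff_mul_eq_one, el_mul, ← el_one]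
  congr 1
  · rw [mul_neg, ← mul_assoc, sg_mul_self]; ring
  · ring

theorem el_inj {a b : ZMod k} {n m : ℤ} (h : el a n = el b m) : a = b ∧ n = m := by
  exact ⟨ofAdd.injective (congrArg SemidirectProduct.left h),
    ofAdd.injective (congrArg SemidirectProduct.right h)⟩

theorem el_surj (g : DeltaK k) : ∃ a n, g = el a n :=
  ⟨toAdd g.left, toAdd g.right, rfl⟩

instance : Countable (DeltaK k) := by
  have : Function.Surjective (fun p : ZMod k × ℤ => el p.1 p.2) := fun g => by
    obtain ⟨a, n, rfl⟩ := el_surj g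
    exact ⟨(a, n), rfl⟩
  have hc : Countable (ZMod k) := by
    cases k with
    | zero => exact inferInstanceAs (Countable ℤ)
    | succ n => infer_instance
  exact this.countable

instance : Infinite (DeltaK k) :=
  Infinite.of_injective (fun n : ℤ => el (0 : ZMod k) n) fun _ _ h => (el_inj h).2

theorem mem_TK {a : ZMod k} {n : ℤ} : el a n ∈ TK k ↔
    (n = 0 ∧ a ≠ 0) ∨ (n = 1 ∧ a ≠ 0 ∧ a ≠ 1) ∨ (n = -1 ∧ a ≠ 0 ∧ a ≠ 1) := by
  constructor
  · rintro ((⟨i, h1, h2⟩ | ⟨i, h1, h3, h2⟩) | ⟨i, h1, h3, h2⟩)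
    · obtain ⟨rfl, rfl⟩ := el_inj (show el a n = el i 0 from h2)
      exact Or.inl ⟨rfl, h1⟩
    · obtain ⟨rfl, rfl⟩ := el_inj (show el a n = el i 1 from h2)
      exact Or.inr (Or.inl ⟨rfl, h1, h3⟩)
    · obtain ⟨rfl, rfl⟩ := el_inj (show el a n = el i (-1) from h2)
      exact Or.inr (Or.inr ⟨rfl, h1, h3⟩)
  · rintro (⟨rfl, h⟩ | ⟨rfl, h, h'⟩ | ⟨rfl, h, h'⟩)
    · exact Or.inl (Or.inl ⟨a, h, rfl⟩)
    · exact Or.inl (Or.inr ⟨a, h, h', rfl⟩)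
    · exact Or.inr ⟨a, h, h', rfl⟩

theorem adj_act {g : DeltaK k} (hg : g ∈ TK k) (x : FreePart (DeltaK k)) :
    ShiftAdj (TK k) x (act g x) := by
  rw [shiftAdj_iff]
  refine ⟨fun h => ?_, g, hg, rfl⟩
  have h1 : act 1 x = act g x := by rw [act_one]; exact h
  have := act_inj h1
  rw [← this, ← el_one, mem_TK] at hg
  simp at hg

/-- To verify a coloring it is enough to look at levels `0` and `1`. -/
theorem coloring_of {n : ℕ} (c : FreePart (DeltaK k) → Fin n)
    (h0 : ∀ x (a : ZMod k), a ≠ 0 → c (act (el a 0) x) ≠ c x)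
    (h1 : ∀ x (a : ZMod k), a ≠ 0 → a ≠ 1 → c (act (el a 1) x) ≠ c x) :
    ∀ x y, ShiftAdj (TK k) x y → c x ≠ c y := by
  intro x y hxy
  rw [shiftAdj_iff] at hxy
  obtain ⟨-, s, hs, rfl⟩ := hxy
  obtain ⟨a, n, rfl⟩ := el_surj s
  rcases mem_TK.mp hs with ⟨rfl, h⟩ | ⟨rfl, h, h'⟩ | ⟨rfl, h, h'⟩
  · exact (h0 x a h).symm
  · exact (h1 x a h h').symm
  · have := h1 (act (el a (-1)) x) a h h'
    rw [act_act, el_mul, sg_one] at this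
    simpa [el_one, act_one] using this

theorem level_bound (D : Finset (DeltaK k)) :
    ∃ B : ℤ, 0 ≤ B ∧ ∀ a n, el a n ∈ D → |n| ≤ B := by
  classical
  induction D using Finset.induction_on with
  | empty => exact ⟨0, le_rfl, by simp⟩
  | insert g D _ ih =>
    obtain ⟨B, hB, h⟩ := ih
    obtain ⟨b, m, rfl⟩ := el_surj g
    refine ⟨max B |m|, le_max_of_le_left hB, fun a n han => ?_⟩
    rcases Finset.mem_insert.mp han with hmem | hmem
    · rw [(el_inj hmem).2]; exact le_max_right _ _
    · exact le_max_of_le_left (h a n hmem)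

/-- Two bijections which are locally compatible differ by a reflection. -/
theorem reflect_step (hk : 3 ≤ k) (f g : ZMod k → Fin k) (hf : Function.Bijective f)
    (hg : Function.Injective g)
    (h : ∀ a b, f a = g b → a + b = 0 ∨ a + b = 1) : ∃ ε, ∀ b, g b = f (ε - b) := by
  have : NeZero k := ⟨by omega⟩
  by_cases hc : ∃ b, g b = f (0 - b)
  · obtain ⟨b0, hb0⟩ := hc
    refine ⟨0, ?_⟩
    have key : ∀ n : ℕ, g (b0 + n) = f (0 - (b0 + n)) := by
      intro n
      induction n with
      | zero => simpa using hb0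
      | succ n ih =>
        obtain ⟨a, ha⟩ := hf.2 (g (b0 + (n + 1 : ℕ)))
        rcases h a _ ha with h1 | h1
        · rw [← ha]; congr 1; linear_combination h1
        · exfalso
          have : a = 0 - (b0 + n) := by push_cast at h1; linear_combination h1
          rw [this, ← ih] at ha
          have h2 := hg ha
          push_cast at h2
          have h3 : (1 : ZMod k) = 0 := by linear_combination -h2
          have : ((1 : ℕ) : ZMod k) = 0 := by exact_mod_cast h3
          rw [ZMod.natCast_eq_zero_iff] at this
          have := Nat.le_of_dvd one_pos this
          omega
    intro b
    have := key (b - b0).val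
    rw [ZMod.natCast_zmod_val] at this
    simpa using this
  · refine ⟨1, fun b => ?_⟩
    obtain ⟨a, ha⟩ := hf.2 (g b)
    rcases h a b ha with h1 | h1
    · exfalso; apply hc; refine ⟨b, ?_⟩; rw [← ha]; congr 1; linear_combination h1
    · rw [← ha]; congr 1; linear_combination h1

theorem not_two_eq_zero (hk : 3 ≤ k) : (2 : ZMod k) ≠ 0 := by
  intro h
  have : ((2 : ℕ) : ZMod k) = 0 := by exact_mod_cast h
  rw [ZMod.natCast_eq_zero_iff] at this
  have := Nat.le_of_dvd two_pos this
  omega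

theorem iter_reflect (hk : 3 ≤ k) (c : FreePart (DeltaK k) → Fin k)
    (hc : ∀ x y, ShiftAdj (TK k) x y → c x ≠ c y) (x : FreePart (DeltaK k)) (n : ℕ) :
    ∃ ε, ∀ b, c (act (el b n) x) = c (act (el (ε + sg k n * b) 0) x) := by
  have : NeZero k := ⟨by omega⟩
  have inj : ∀ n : ℤ, Function.Injective (fun a => c (act (el a n) x)) := by
    intro n a b hab
    by_contra hne
    refine hc (act (el a n) x) (act (el b n) x) ?_ hab
    have : el b n = el (b - a) 0 * el a n := by
      rw [el_mul, sg_zero]; congr 1 <;> ring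
    rw [this, ← act_act]
    apply adj_act
    rw [mem_TK]
    exact Or.inl ⟨rfl, sub_ne_zero.mpr (Ne.symm hne)⟩
  induction n with
  | zero => exact ⟨0, fun b => by simp [sg_zero]⟩
  | succ n ih =>
    obtain ⟨ε, hε⟩ := ih
    obtain ⟨δ, hδ⟩ := reflect_step hk (fun a => c (act (el a n) x))
      (fun a => c (act (el a (n + 1 : ℤ)) x))
      ((Fintype.bijective_iff_injective_and_card _).mpr ⟨inj n, by simp⟩) (inj _) (by
        intro a b hab
        by_contra hne
        rw [not_or] at hne
        refine hc (act (el a n) x) (act (el b (n + 1)) x) ?_ hab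
        have : el b (n + 1 : ℤ) = el (a + b) 1 * el a n := by
          rw [el_mul, sg_one]; congr 1 <;> ring
        rw [this, ← act_act]
        apply adj_act
        rw [mem_TK]
        exact Or.inr (Or.inl ⟨rfl, hne.1, hne.2⟩))
    refine ⟨ε + sg k n * δ, fun b => ?_⟩
    have h1 := hδ b
    push_cast
    rw [h1, hε, sg_succ]
    congr 3; ring

theorem no_baire_coloring (hk : 3 ≤ k) : ¬ HasBaireColoring (ShiftAdj (TK k)) k := by
  classical
  have : NeZero k := ⟨by omega⟩
  have : BaireSpace (FreePart (DeltaK k)) := baire_freePart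
  rintro ⟨c, hm, hc⟩
  let A : (ZMod k → Fin k) → Set (FreePart (DeltaK k)) :=
    fun f => ⋂ a, (act (el a 0)) ⁻¹' (c ⁻¹' {f a})
  have hA : ∀ f, BaireMeasurableSet (A f) := fun f =>
    BaireMeasurableSet.iInter fun a =>
      (hm (f a)).preimage (actHomeo (el a 0)).continuous (actHomeo (el a 0)).isOpenMap
  choose U hU hAU using fun f => (hA f).residualEq_isOpen
  have hne : ∃ f, (U f).Nonempty := by
    have hall : ∀ᶠ x in residual (FreePart (DeltaK k)), ∀ f, x ∈ A f ↔ x ∈ U f := by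
      rw [Filter.eventually_all]
      exact fun f => (Filter.eventuallyEq_set.mp (hAU f))
    obtain ⟨p, -⟩ := exists_free_agree (∅ : Finset (DeltaK k)) (fun _ => true)
    obtain ⟨x, hx, -⟩ := (dense_of_mem_residual hall).inter_open_nonempty _ isOpen_univ ⟨p, trivial⟩ |>.imp fun _ h => h.symm
    refine ⟨fun a => c (act (el a 0) x), x, (hx _).mp ?_⟩
    simp [A]
  obtain ⟨f, x, hx⟩ := hne
  obtain ⟨D, hD⟩ := open_nhd_free (hU f) hx
  obtain ⟨B, hB0, hB⟩ := level_bound D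
  let n : ℕ := 2 * B.toNat + 1
  let t : DeltaK k := el 0 n
  obtain ⟨z, hz⟩ := exists_free_agree (D ∪ D.image (fun d => t⁻¹ * d))
    (fun g => if g ∈ D then x.1 g else x.1 (t * g))
  have hz1 : z ∈ U f := by
    apply hD
    intro d hd
    rw [hz d (Finset.mem_union_left _ hd)]
    simp [hd]
  have hz2 : act t z ∈ U f := by
    apply hD
    intro d hd
    have h1 := hz (t⁻¹ * d) (Finset.mem_union_right _ (Finset.mem_image_of_mem _ hd))
    have h2 : t⁻¹ * d ∉ D := by
      obtain ⟨a, m, rfl⟩ := el_surj d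
      intro h3
      have h4 := hB _ _ hd
      simp only [t] at h3
      rw [el_inv, el_mul] at h3
      have h5 := hB _ _ h3
      rw [abs_le] at h4 h5
      simp only [n] at h5
      push_cast at h5
      omega
    rw [if_neg h2] at h1
    simpa [act, shiftMap] using h1
  have hopen : IsOpen (U f ∩ (act t) ⁻¹' (U f)) := (hU f).inter ((hU f).preimage (continuous_act t))
  have hres : ∀ᶠ y in residual (FreePart (DeltaK k)),
      (y ∈ A f ↔ y ∈ U f) ∧ (act t y ∈ A f ↔ act t y ∈ U f) :=
    (Filter.eventuallyEq_set.mp (hAU f)).and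
      ((tendsto_residual_of_isOpenMap (actHomeo t).continuous (actHomeo t).isOpenMap).eventually
        (Filter.eventuallyEq_set.mp (hAU f)))
  obtain ⟨y, ⟨hy1, hy2⟩, hy3, hy4⟩ :=
    (dense_of_mem_residual hres).inter_open_nonempty _ hopen ⟨z, hz1, hz2⟩
  have e1 := hy3.mpr hy1
  have e2 := hy4.mpr hy2
  simp only [A, Set.mem_iInter, Set.mem_preimage, Set.mem_singleton_iff] at e1 e2
  obtain ⟨ε, hε⟩ := iter_reflect hk c hc y n
  have hodd : sg k n = -1 := by
    simp only [n]
    push_cast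
    rw [sg_succ, two_mul, sg_add, sg_mul_self]
  have hfin : ∀ b, b = ε - b := by
    intro b
    have h1 := e2 b
    rw [act_act] at h1
    simp only [t] at h1
    rw [el_mul, sg_zero, mul_zero, add_zero, zero_add, hε, hodd, ← e1 b] at h1
    by_contra hne
    refine hc _ _ ?_ h1
    have : el b 0 = el (b - (ε + -1 * b)) 0 * el (ε + -1 * b) 0 := by
      rw [el_mul, sg_zero]; congr 1; ring
    rw [this, ← act_act]
    apply adj_act
    rw [mem_TK]
    refine Or.inl ⟨rfl, fun h => hne ?_⟩
    linear_combination h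
  apply not_two_eq_zero hk
  linear_combination hfin 1 - hfin 0

end Delta

section Paths

variable {k : ℕ}

/-- Compatibility of the colorings of two consecutive levels. -/
def Rl (f g : ZMod k → Fin (k + 1)) : Prop := ∀ a b, f a = g b → a + b = 0 ∨ a + b = 1

theorem Rl.symm {f g : ZMod k → Fin (k + 1)} (h : Rl f g) : Rl g f := fun a b hab => by
  rw [add_comm]; exact h b a hab.symm

/-- Paths of compatible injective level colorings. -/
inductive Pth : ℕ → (ZMod k → Fin (k + 1)) → (ZMod k → Fin (k + 1)) → Prop
  | nil {f : ZMod k → Fin (k + 1)} (hf : Function.Injective f) : Pth 0 f f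
  | cons {n : ℕ} {f g h : ZMod k → Fin (k + 1)} (hf : Function.Injective f) (hr : Rl f g)
      (hp : Pth n g h) : Pth (n + 1) f h

theorem Pth.left_inj {n : ℕ} {f g : ZMod k → Fin (k + 1)} (h : Pth n f g) :
    Function.Injective f := by
  cases h <;> assumption

theorem Pth.trans {n m : ℕ} {f g h : ZMod k → Fin (k + 1)} (h1 : Pth n f g) (h2 : Pth m g h) :
    Pth (n + m) f h := by
  induction h1 with
  | nil hf => simpa using h2
  | cons hf hr hp ih =>
    rw [Nat.add_right_comm]
    exact Pth.cons hf hr (ih h2)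

theorem Pth.symm {n : ℕ} {f g : ZMod k → Fin (k + 1)} (h1 : Pth n f g) : Pth n g f := by
  induction h1 with
  | nil hf => exact Pth.nil hf
  | cons hf hr hp ih =>
    exact ih.trans (Pth.cons hp.left_inj hr.symm (Pth.nil hf))

theorem Pth.seq {n : ℕ} {f g : ZMod k → Fin (k + 1)} (h1 : Pth n f g) :
    ∃ s : ℕ → ZMod k → Fin (k + 1), s 0 = f ∧ s n = g ∧
      (∀ j ≤ n, Function.Injective (s j)) ∧ ∀ j < n, Rl (s j) (s (j + 1)) := by
  induction h1 with
  | @nil f hf => exact ⟨fun _ => f, rfl, rfl, fun _ _ => hf, fun j hj => absurd hj (by omega)⟩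
  | @cons n f g h hf hr hp ih =>
    obtain ⟨s, h0, hn, hi, hs⟩ := ih
    refine ⟨fun j => Nat.casesOn j f s, rfl, hn, ?_, ?_⟩
    · rintro (_ | j) hj
      · exact hf
      · exact hi j (by omega)
    · rintro (_ | j) hj
      · change Rl f (s 0)
        rw [h0]; exact hr
      · exact hs j (by omega)

theorem inj_neg {f : ZMod k → Fin (k + 1)} (hf : Function.Injective f) :
    Function.Injective (fun b => f (-b)) := fun a b h => neg_injective (hf h)

theorem rl_neg {f : ZMod k → Fin (k + 1)} (hf : Function.Injective f) :
    Rl f (fun b => f (-b)) := fun a b h => Or.inl (by rw [hf h]; ring)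

theorem Pth.wait {n : ℕ} {f g : ZMod k → Fin (k + 1)} (h : Pth n f g) (m : ℕ) :
    Pth (n + 2 * m) f g := by
  induction m with
  | zero => simpa using h
  | succ m ih =>
    exact Pth.cons h.left_inj (rl_neg h.left_inj)
      (Pth.cons (inj_neg h.left_inj) (rl_neg h.left_inj).symm ih)

/-- Connectedness by paths of even length. -/
def Ev (f g : ZMod k → Fin (k + 1)) : Prop := ∃ n, Pth (2 * n) f g

theorem Ev.trans {f g h : ZMod k → Fin (k + 1)} (h1 : Ev f g) (h2 : Ev g h) : Ev f h := by
  obtain ⟨n, hn⟩ := h1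
  obtain ⟨m, hm⟩ := h2
  refine ⟨n + m, ?_⟩
  rw [mul_add]; exact hn.trans hm

theorem ev_rot {f : ZMod k → Fin (k + 1)} (hf : Function.Injective f) :
    Ev f (fun b => f (b - 1)) := by
  refine ⟨1, Pth.cons hf (rl_neg hf) (Pth.cons (inj_neg hf) ?_ (Pth.nil ?_))⟩
  · intro a b h
    right
    have := hf h
    linear_combination -this
  · intro a b h
    exact sub_left_injective (hf h)

theorem ev_swap (hk : 3 ≤ k) {f : ZMod k → Fin (k + 1)} (hf : Function.Injective f) (p : ZMod k) :
    Ev f (fun b => f (Equiv.swap p (p - 1) b)) := by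
  classical
  have : NeZero k := ⟨by omega⟩
  obtain ⟨w, hw⟩ : ∃ w, ∀ a, f a ≠ w := by
    by_contra hcon
    push Not at hcon
    have := Fintype.card_le_of_surjective f hcon
    simp at this
  have hf1 : Function.Injective (Function.update f p w) := by
    intro a b hab
    by_cases ha : a = p <;> by_cases hb : b = p
    · rw [ha, hb]
    · subst ha; rw [Function.update_self, Function.update_of_ne hb] at hab
      exact absurd hab.symm (hw b)
    · subst hb; rw [Function.update_self, Function.update_of_ne ha] at hab
      exact absurd hab (hw a)
    · rw [Function.update_of_ne hb, Function.update_of_ne ha] at hab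
      exact hf hab
  refine ⟨1, Pth.cons (g := fun b => Function.update f p w (-b)) hf ?_
    (Pth.cons (inj_neg hf1) ?_ (Pth.nil ?_))⟩
  · intro a b h
    by_cases hb : -b = p
    · simp only [hb, Function.update_self] at h
      exact absurd h (hw a)
    · simp only [Function.update_of_ne hb] at h
      left; rw [hf h]; ring
  · intro a b h
    by_cases ha : -a = p
    · simp only [ha, Function.update_self] at h
      exact absurd h.symm (hw _)
    · simp only [Function.update_of_ne ha] at h
      have h1 := hf h
      by_cases hb : b = p
      · right
        rw [hb, Equiv.swap_apply_left] at h1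
        rw [hb]; linear_combination -h1
      · by_cases hb' : b = p - 1
        · rw [hb', Equiv.swap_apply_right] at h1
          exact absurd h1 ha
        · rw [Equiv.swap_apply_of_ne_of_ne hb hb'] at h1
          left; linear_combination -h1
  · exact hf.comp (Equiv.injective _)

theorem ev_perm (hk : 3 ≤ k) (π : Equiv.Perm (ZMod k)) :
    ∀ f : ZMod k → Fin (k + 1), Function.Injective f → Ev f (fun b => f (π b)) := by
  classical
  have : NeZero k := ⟨by omega⟩
  have h1 : (1 : ZMod k) ≠ 0 := fun h => not_two_eq_zero hk (by linear_combination 2 * h)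
  let σ : Equiv.Perm (ZMod k) := Equiv.addRight (-1)
  have hσ : ∀ b, σ b = b - 1 := fun b => by simp [σ, sub_eq_add_neg]
  have hne : ∀ b, σ b ≠ b := fun b h => by
    rw [hσ] at h; apply h1; linear_combination -h
  have hcyc : σ.IsCycle := by
    refine ⟨0, hne 0, fun y _ => ?_⟩
    refine ⟨((-y).val : ℤ), ?_⟩
    have hp : ∀ n : ℕ, (σ ^ n) 0 = -(n : ZMod k) := by
      intro n
      induction n with
      | zero => simp
      | succ n ih =>
        rw [pow_succ', Equiv.Perm.mul_apply, ih, hσ]; push_cast; ring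
    rw [zpow_natCast, hp, ZMod.natCast_zmod_val, neg_neg]
  have hsup : σ.support = Finset.univ := by
    ext b; simp [hne]
  have hcl := Equiv.Perm.closure_cycle_adjacent_swap hcyc hsup 0
  have hmem : π ∈ Subgroup.closure ({σ, Equiv.swap 0 (σ 0)} : Set (Equiv.Perm (ZMod k))) := by
    rw [hcl]; trivial
  induction hmem using Subgroup.closure_induction with
  | mem τ hτ =>
    intro f hf
    rcases hτ with rfl | hτ
    · simpa only [hσ] using ev_rot hf
    · rw [Set.mem_singleton_iff] at hτ
      subst hτ
      rw [hσ]; exact ev_swap hk hf 0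
  | one => intro f hf; exact ⟨0, Pth.nil hf⟩
  | mul τ ρ _ _ h2 h3 =>
    intro f hf
    exact (h2 f hf).trans (h3 _ (hf.comp τ.injective))
  | inv τ _ h2 =>
    intro f hf
    obtain ⟨n, hn⟩ := h2 (fun b => f (τ⁻¹ b)) (hf.comp (τ⁻¹).injective)
    refine ⟨n, ?_⟩
    have := hn.symm
    simpa using this

theorem long_paths (hk : 3 ≤ k) (f : ZMod k → Fin (k + 1)) (hf : Function.Injective f) :
    ∃ M : ℕ, ∀ n ≥ M, ∀ d, Pth n f (fun b => f (b + d)) := by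
  classical
  have : NeZero k := ⟨by omega⟩
  have h1 : ∀ d : ZMod k, ∃ n, Pth (2 * n) f (fun b => f (b + d)) := fun d =>
    ev_perm hk (Equiv.addRight d) f hf
  have h2 : ∀ d : ZMod k, ∃ n, Pth (2 * n) (fun b => f (-b)) (fun b => f (b + d)) := fun d => by
    have := ev_perm hk ((Equiv.addRight d).trans (Equiv.neg _)) _ (inj_neg hf)
    simpa [Ev] using this
  choose u hu using h1
  choose v hv using h2
  refine ⟨2 * Finset.univ.sup u + 2 * Finset.univ.sup v + 1, fun n hn d => ?_⟩
  have b1 : u d ≤ Finset.univ.sup u := Finset.le_sup (Finset.mem_univ d)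
  have b2 : v d ≤ Finset.univ.sup v := Finset.le_sup (Finset.mem_univ d)
  rcases Nat.even_or_odd' n with ⟨m, rfl | rfl⟩
  · have := (hu d).wait (m - u d)
    convert this using 1; omega
  · have := (Pth.cons hf (rl_neg hf) (hv d)).wait (m - v d)
    convert this using 1; omega

theorem exists_seqs (hk : 3 ≤ k) (f : ZMod k → Fin (k + 1)) (hf : Function.Injective f) :
    ∃ (M : ℕ) (s : ℕ → ZMod k → ℕ → ZMod k → Fin (k + 1)), ∀ n ≥ M, ∀ d,
      s n d 0 = f ∧ s n d n = (fun b => f (b + d)) ∧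
      (∀ j ≤ n, Function.Injective (s n d j)) ∧ ∀ j < n, Rl (s n d j) (s n d (j + 1)) := by
  obtain ⟨M, hM⟩ := long_paths hk f hf
  have : ∀ n d, ∃ s : ℕ → ZMod k → Fin (k + 1), n ≥ M →
      s 0 = f ∧ s n = (fun b => f (b + d)) ∧
      (∀ j ≤ n, Function.Injective (s j)) ∧ ∀ j < n, Rl (s j) (s (j + 1)) := by
    intro n d
    by_cases h : n ≥ M
    · obtain ⟨s, hs⟩ := (hM n h d).seq
      exact ⟨s, fun _ => hs⟩
    · exact ⟨fun _ => f, fun h' => absurd h' h⟩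
  choose s hs using this
  exact ⟨M, s, fun n hn d => hs n d hn⟩

end Paths

section Markers

variable {k : ℕ}

/-- The label of the point `(a, n) · x`. -/
def Lb (x : FreePart (DeltaK k)) (a : ZMod k) (n : ℤ) : Bool := x.1 (el a n)⁻¹

theorem Lb_act (x : FreePart (DeltaK k)) (i a : ZMod k) (m n : ℤ) :
    Lb (act (el i m) x) a n = Lb x (a + sg k n * i) (n + m) := by
  simp only [Lb, act, shiftMap]
  rw [← mul_inv_rev, el_mul]

/-- The level `n` of the orbit of `x` is a marker level with distinguished position `a`. -/
def Mk (M : ℕ) (x : FreePart (DeltaK k)) (n : ℤ) (a : ZMod k) : Prop :=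
  Lb x a n = true ∧ (∀ b, b ≠ a → Lb x b n = false) ∧
    ∀ j : ℤ, 0 < j ∧ j ≤ M → ∀ b, Lb x b (n + j) = false

theorem Mk_act (M : ℕ) (x : FreePart (DeltaK k)) (i a : ZMod k) (m n : ℤ) :
    Mk M (act (el i m) x) n a ↔ Mk M x (n + m) (a + sg k n * i) := by
  simp only [Mk, Lb_act]
  refine and_congr Iff.rfl (and_congr ?_ ?_)
  · constructor
    · intro h b hb
      have := h (b - sg k n * i) (fun e => hb (by rw [← e]; ring))
      simpa using this
    · intro h b hb
      exact h _ (fun e => hb (add_right_cancel e))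
  · refine forall_congr' fun j => forall_congr' fun _ => ?_
    have e : n + j + m = n + m + j := by ring
    rw [e]
    constructor
    · intro h b
      have := h (b - sg k (n + j) * i)
      simpa using this
    · intro h b
      exact h _

theorem Mk_unique {M : ℕ} {x : FreePart (DeltaK k)} {n : ℤ} {a b : ZMod k}
    (h1 : Mk M x n a) (h2 : Mk M x n b) : a = b := by
  by_contra hne
  have := h2.2.1 a hne
  rw [h1.1] at this
  exact absurd this (by simp)

theorem Mk_sep {M : ℕ} {x : FreePart (DeltaK k)} {n m : ℤ} {a b : ZMod k}
    (h1 : Mk M x n a) (h2 : Mk M x m b) (h : n < m) : n + M < m := by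
  by_contra hne
  have := h1.2.2 (m - n) ⟨by omega, by omega⟩ b
  rw [add_sub_cancel, h2.1] at this
  exact absurd this (by simp)

theorem isOpen_Lb (a : ZMod k) (n : ℤ) (v : Bool) :
    IsOpen {x : FreePart (DeltaK k) | Lb x a n = v} := by
  have : Continuous (fun x : FreePart (DeltaK k) => Lb x a n) :=
    (continuous_apply _).comp continuous_subtype_val
  exact (isOpen_discrete {v}).preimage this

theorem isOpen_Mk [NeZero k] (M : ℕ) (n : ℤ) (a : ZMod k) :
    IsOpen {x : FreePart (DeltaK k) | Mk M x n a} := by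
  have e : {x : FreePart (DeltaK k) | Mk M x n a} =
      {x | Lb x a n = true} ∩ ((⋂ b, ⋂ (_ : b ≠ a), {x | Lb x b n = false}) ∩
        ⋂ j ∈ Set.Ioc (0 : ℤ) M, ⋂ b, {x | Lb x b (n + j) = false}) := by
    ext x; simp [Mk]
  rw [e]
  refine (isOpen_Lb _ _ _).inter (IsOpen.inter ?_ ?_)
  · exact isOpen_iInter_of_finite fun b => isOpen_iInter_of_finite fun _ => isOpen_Lb _ _ _
  · exact (Set.finite_Ioc _ _).isOpen_biInter fun j _ =>
      isOpen_iInter_of_finite fun b => isOpen_Lb _ _ _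

/-- Existence of points with a marker at a remote level. -/
theorem exists_Mk [NeZero k] (M : ℕ) {V : Set (FreePart (DeltaK k))} (hV : IsOpen V)
    (hne : V.Nonempty) :
    ∃ B : ℤ, 0 ≤ B ∧ ∀ n : ℤ, (∀ j : ℤ, 0 ≤ j → j ≤ M → B < |n + j|) → ∃ y ∈ V, Mk M y n 0 := by
  classical
  obtain ⟨x, hx⟩ := hne
  obtain ⟨D, hD⟩ := open_nhd_free hV hx
  obtain ⟨B, hB0, hB⟩ := level_bound D
  refine ⟨B, hB0, fun n hn => ?_⟩
  let W : Finset (DeltaK k) := (Finset.univ ×ˢ Finset.Icc (0 : ℤ) M).image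
    (fun p : ZMod k × ℤ => (el p.1 (n + p.2))⁻¹)
  obtain ⟨y, hy⟩ := exists_free_agree (D ∪ W)
    (fun g => if g ∈ D then x.1 g else decide (g = (el 0 n)⁻¹))
  have key : ∀ j : ℤ, 0 ≤ j → j ≤ M → ∀ b, Lb y b (n + j) = decide (b = 0 ∧ j = 0) := by
    intro j h0 h1 b
    have hW : (el b (n + j))⁻¹ ∈ W :=
      Finset.mem_image.mpr ⟨(b, j), by simp [h0, h1], rfl⟩
    have hnD : (el b (n + j))⁻¹ ∉ D := by
      intro h
      rw [el_inv] at h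
      have := hB _ _ h
      rw [abs_neg] at this
      exact absurd this (not_le.mpr (hn j h0 h1))
    have := hy _ (Finset.mem_union_right _ hW)
    rw [if_neg hnD] at this
    unfold Lb
    rw [this, decide_eq_decide, inv_inj]
    constructor
    · intro h; have := el_inj h; exact ⟨this.1, by linarith [this.2]⟩
    · rintro ⟨rfl, rfl⟩; simp
  refine ⟨y, hD y fun d hd => ?_, ?_, ?_, ?_⟩
  · rw [hy d (Finset.mem_union_left _ hd), if_pos hd]
  · have := key 0 le_rfl (by positivity) 0
    simpa using this
  · intro b hb
    have := key 0 le_rfl (by positivity) b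
    simpa [hb] using this
  · rintro j ⟨h0, h1⟩ b
    have := key j h0.le h1 b
    rw [this]
    simp [ne_of_gt h0]

/-- Points having markers arbitrarily far in both directions. -/
def Good (M : ℕ) (x : FreePart (DeltaK k)) : Prop :=
  (∀ m : ℤ, ∃ n a, m ≤ n ∧ Mk M x n a) ∧ (∀ m : ℤ, ∃ n a, n ≤ m ∧ Mk M x n a)

theorem good_residual [NeZero k] (M : ℕ) :
    ∀ᶠ x in residual (FreePart (DeltaK k)), Good M x := by
  refine Filter.Eventually.and ?_ ?_
  · rw [eventually_countable_forall]
    intro m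
    refine residual_of_dense_open ?_ ?_
    · simp only [Set.ofPred_exists, Set.ofPred_and]
      exact isOpen_iUnion fun n => isOpen_iUnion fun a => isOpen_const.inter (isOpen_Mk M n a)
    · rw [dense_iff_inter_open]
      intro V hV hne
      obtain ⟨B, hB0, hB⟩ := exists_Mk M hV hne
      obtain ⟨y, hy, hm⟩ := hB (max m (B + 1)) (by
        intro j h0 h1
        rw [abs_of_nonneg] <;> omega)
      exact ⟨y, hy, _, _, le_max_left _ _, hm⟩
  · rw [eventually_countable_forall]
    intro m
    refine residual_of_dense_open ?_ ?_
    · simp only [Set.ofPred_exists, Set.ofPred_and]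
      exact isOpen_iUnion fun n => isOpen_iUnion fun a => isOpen_const.inter (isOpen_Mk M n a)
    · rw [dense_iff_inter_open]
      intro V hV hne
      obtain ⟨B, hB0, hB⟩ := exists_Mk M hV hne
      obtain ⟨y, hy, hm⟩ := hB (min m (-(B + 1 + M))) (by
        intro j h0 h1
        rw [abs_of_nonpos] <;> omega)
      exact ⟨y, hy, _, _, min_le_left _ _, hm⟩

theorem Good.act {M : ℕ} {x : FreePart (DeltaK k)} (h : Good M x) (g : DeltaK k) :
    Good M (act g x) := by
  obtain ⟨i, m, rfl⟩ := el_surj g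
  constructor
  · intro l
    obtain ⟨n, a, h1, h2⟩ := h.1 (l + m)
    refine ⟨n - m, a - sg k (n - m) * i, by omega, ?_⟩
    rw [Mk_act]; simpa using h2
  · intro l
    obtain ⟨n, a, h1, h2⟩ := h.2 (l + m)
    refine ⟨n - m, a - sg k (n - m) * i, by omega, ?_⟩
    rw [Mk_act]; simpa using h2

theorem good_act_iff {M : ℕ} {x : FreePart (DeltaK k)} (g : DeltaK k) :
    Good M (act g x) ↔ Good M x := by
  refine ⟨fun h => ?_, fun h => h.act g⟩
  have := h.act g⁻¹
  rw [act_act] at this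
  simpa [act_one] using this

/-- The two markers surrounding the level of `x`. -/
def Dat (M : ℕ) (x : FreePart (DeltaK k)) (n0 : ℤ) (a0 : ZMod k) (n1 : ℤ) (a1 : ZMod k) : Prop :=
  n0 ≤ 0 ∧ 0 < n1 ∧ Mk M x n0 a0 ∧ Mk M x n1 a1 ∧ ∀ n a, n0 < n → n < n1 → ¬ Mk M x n a

theorem Dat_unique {M : ℕ} {x : FreePart (DeltaK k)} {n0 n1 m0 m1 : ℤ} {a0 a1 b0 b1 : ZMod k}
    (h : Dat M x n0 a0 n1 a1) (h' : Dat M x m0 b0 m1 b1) :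
    n0 = m0 ∧ a0 = b0 ∧ n1 = m1 ∧ a1 = b1 := by
  obtain ⟨p1, p2, p3, p4, p5⟩ := h
  obtain ⟨q1, q2, q3, q4, q5⟩ := h'
  have e0 : n0 = m0 := by
    rcases lt_trichotomy n0 m0 with hl | hl | hl
    · exact absurd q3 (p5 _ _ hl (by omega))
    · exact hl
    · exact absurd p3 (q5 _ _ hl (by omega))
  have e1 : n1 = m1 := by
    rcases lt_trichotomy n1 m1 with hl | hl | hl
    · exact absurd p4 (q5 _ _ (by omega) hl)
    · exact hl
    · exact absurd q4 (p5 _ _ (by omega) hl)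
  subst e0 e1
  exact ⟨rfl, Mk_unique p3 q3, rfl, Mk_unique p4 q4⟩

theorem Dat_exists {M : ℕ} {x : FreePart (DeltaK k)} (h : Good M x) :
    ∃ n0 a0 n1 a1, Dat M x n0 a0 n1 a1 := by
  obtain ⟨n0, ⟨h0, a0, m0⟩, g0⟩ := Int.exists_greatest_of_bdd
    (P := fun n => n ≤ 0 ∧ ∃ a, Mk M x n a) ⟨0, fun z hz => hz.1⟩ (by
      obtain ⟨n, a, h1, h2⟩ := h.2 0
      exact ⟨n, h1, a, h2⟩)
  obtain ⟨n1, ⟨h1, a1, m1⟩, g1⟩ := Int.exists_least_of_bdd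
    (P := fun n => 1 ≤ n ∧ ∃ a, Mk M x n a) ⟨1, fun z hz => hz.1⟩ (by
      obtain ⟨n, a, h1, h2⟩ := h.1 1
      exact ⟨n, h1, a, h2⟩)
  refine ⟨n0, a0, n1, a1, h0, by omega, m0, m1, fun n a hn hn' hm => ?_⟩
  by_cases hc : n ≤ 0
  · have := g0 n ⟨hc, a, hm⟩; omega
  · have := g1 n ⟨by omega, a, hm⟩; omega

theorem baire_Dat [NeZero k] (M : ℕ) (n0 : ℤ) (a0 : ZMod k) (n1 : ℤ) (a1 : ZMod k) :
    BaireMeasurableSet {x : FreePart (DeltaK k) | Dat M x n0 a0 n1 a1} := by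
  have e : {x : FreePart (DeltaK k) | Dat M x n0 a0 n1 a1} =
      {_x | n0 ≤ 0} ∩ ({_x | 0 < n1} ∩ ({x | Mk M x n0 a0} ∩ ({x | Mk M x n1 a1} ∩
        ⋂ n, ⋂ a, ⋂ (_ : n0 < n), ⋂ (_ : n < n1), {x | Mk M x n a}ᶜ))) := by
    ext x; simp [Dat]
  rw [e]
  refine isOpen_const.baireMeasurableSet.inter (isOpen_const.baireMeasurableSet.inter
    ((isOpen_Mk _ _ _).baireMeasurableSet.inter ((isOpen_Mk _ _ _).baireMeasurableSet.inter ?_)))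
  exact .iInter fun n => .iInter fun a => .iInter fun _ => .iInter fun _ =>
    (isOpen_Mk _ _ _).baireMeasurableSet.compl

theorem Dat_act {M : ℕ} {x : FreePart (DeltaK k)} {n0 n1 : ℤ} {a0 a1 : ZMod k}
    (h : Dat M x n0 a0 n1 a1) (i : ZMod k) (m : ℤ) (hm0 : n0 ≤ m) (hm1 : m < n1) :
    Dat M (act (el i m) x) (n0 - m) (a0 - sg k (n0 - m) * i) (n1 - m)
      (a1 - sg k (n1 - m) * i) := by
  obtain ⟨p1, p2, p3, p4, p5⟩ := h
  refine ⟨by omega, by omega, ?_, ?_, ?_⟩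
  · rw [Mk_act]; simpa using p3
  · rw [Mk_act]; simpa using p4
  · intro n a h1 h2
    rw [Mk_act]
    exact p5 _ _ (by omega) (by omega)

/-- A coloring without any regularity. -/
theorem exists_wild (f : ZMod k → Fin (k + 1)) (hf : Function.Injective f) :
    ∃ c : FreePart (DeltaK k) → Fin (k + 1),
      ∀ x (i : ZMod k) (m : ℤ), i ≠ 0 → c (act (el i m) x) ≠ c x := by
  let S : Setoid (FreePart (DeltaK k)) :=
    { r := fun x y => ∃ g, act g x = y
      iseqv := ⟨fun x => ⟨1, act_one x⟩,
        fun {x y} ⟨g, h⟩ => ⟨g⁻¹, by rw [← h, act_act]; simp [act_one]⟩,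
        fun {x y z} ⟨g, h⟩ ⟨g', h'⟩ => ⟨g' * g, by rw [← h', ← h, act_act]⟩⟩ }
  let r : FreePart (DeltaK k) → FreePart (DeltaK k) := fun x => (Quotient.mk S x).out
  have hr : ∀ x, ∃ a n, act (el a n) (r x) = x := by
    intro x
    obtain ⟨g, hg⟩ : ∃ g, act g (r x) = x := Quotient.exact (s := S) (Quotient.out_eq _)
    obtain ⟨a, n, rfl⟩ := el_surj g
    exact ⟨a, n, hg⟩
  choose a n han using hr
  refine ⟨fun x => f (sg k (n x) * a x), fun x i m hi he => ?_⟩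
  have hrr : r (act (el i m) x) = r x := by
    have : Quotient.mk S x = Quotient.mk S (act (el i m) x) := Quotient.sound ⟨_, rfl⟩
    simp only [r, this]
  have h1 := han (act (el i m) x)
  rw [hrr] at h1
  replace h1 := h1.trans (congrArg (act (el i m)) (han x).symm)
  rw [act_act] at h1
  have h2 := act_inj h1
  rw [el_mul] at h2
  obtain ⟨h3, h4⟩ := el_inj h2
  have h5 := hf he
  rw [h3, h4, sg_add] at h5
  apply hi
  have s1 := sg_mul_self (k := k) m
  have s2 := sg_mul_self (k := k) (n x)
  linear_combination (sg k m * sg k (n x)) * h5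
    - (i * sg k (n x) ^ 2 + sg k m * sg k (n x) ^ 2 * a x) * s1 - i * s2

theorem has_baire_coloring (hk : 3 ≤ k) : HasBaireColoring (ShiftAdj (TK k)) (k + 1) := by
  classical
  have : NeZero k := ⟨by omega⟩
  obtain ⟨f, hf⟩ : ∃ f : ZMod k → Fin (k + 1), Function.Injective f := by
    have : Fintype.card (ZMod k) ≤ Fintype.card (Fin (k + 1)) := by simp
    obtain ⟨e⟩ := Function.Embedding.nonempty_of_card_le this
    exact ⟨e, e.injective⟩
  obtain ⟨M, s, hs⟩ := exists_seqs hk f hf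
  obtain ⟨w, hw⟩ := exists_wild f hf
  let val : ℤ → ZMod k → ℤ → ZMod k → Fin (k + 1) := fun n0 a0 n1 a1 =>
    s (n1 - n0).toNat (sg k (n1 - n0) * a0 - a1) (-n0).toNat (-(sg k n0 * a0))
  obtain ⟨c, hc1, hc2⟩ : ∃ c : FreePart (DeltaK k) → Fin (k + 1),
      (∀ x, Good M x → ∀ n0 a0 n1 a1, Dat M x n0 a0 n1 a1 → c x = val n0 a0 n1 a1) ∧
      (∀ x, ¬ Good M x → c x = w x) := by
    have : ∀ x, ∃ v, (Good M x → ∀ n0 a0 n1 a1, Dat M x n0 a0 n1 a1 → v = val n0 a0 n1 a1) ∧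
        (¬ Good M x → v = w x) := by
      intro x
      by_cases hx : Good M x
      · obtain ⟨n0, a0, n1, a1, h⟩ := Dat_exists hx
        refine ⟨val n0 a0 n1 a1, fun _ m0 b0 m1 b1 h' => ?_, fun h' => absurd hx h'⟩
        obtain ⟨rfl, rfl, rfl, rfl⟩ := Dat_unique h h'
        rfl
      · exact ⟨w x, fun h => absurd h hx, fun _ => rfl⟩
    choose c hc using this
    exact ⟨c, fun x => (hc x).1, fun x => (hc x).2⟩
  -- color of the translates, between two markers
  have hmid : ∀ x, Good M x → ∀ n0 a0 n1 a1, Dat M x n0 a0 n1 a1 → ∀ i m, n0 ≤ m → m < n1 →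
      c (act (el i m) x) = s (n1 - n0).toNat (sg k (n1 - n0) * a0 - a1) (m - n0).toNat
        (i - sg k (n0 - m) * a0) := by
    intro x hx n0 a0 n1 a1 h i m h0 h1
    rw [hc1 _ (hx.act _) _ _ _ _ (Dat_act h i m h0 h1)]
    simp only [val]
    have e1 : n1 - m - (n0 - m) = n1 - n0 := by ring
    have e2 : -(n0 - m) = m - n0 := by ring
    rw [e1, e2]
    congr 1
    · have e3 : sg k (n1 - m) = sg k (n1 - n0) * sg k (n0 - m) := by
        rw [← sg_add]; congr 1; ring
      rw [e3]; ring
    · have := sg_mul_self (k := k) (n0 - m)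
      linear_combination i * this
  refine ⟨c, ?_, coloring_of c ?_ ?_⟩
  · intro v
    have hB : BaireMeasurableSet (⋃ p : ℤ × ZMod k × ℤ × ZMod k,
        ⋃ (_ : val p.1 p.2.1 p.2.2.1 p.2.2.2 = v),
          {x : FreePart (DeltaK k) | Dat M x p.1 p.2.1 p.2.2.1 p.2.2.2}) :=
      .iUnion fun p => .iUnion fun _ => baire_Dat _ _ _ _ _
    refine hB.congr ?_
    rw [Filter.eventuallyEq_set]
    filter_upwards [good_residual M] with x hx
    simp only [Set.mem_iUnion, Set.mem_preimage, Set.mem_singleton_iff]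
    constructor
    · rintro ⟨p, hp, hd⟩
      rw [hc1 x hx _ _ _ _ hd]; exact hp
    · intro h
      obtain ⟨n0, a0, n1, a1, hd⟩ := Dat_exists hx
      exact ⟨(n0, a0, n1, a1), by rw [← h, hc1 x hx _ _ _ _ hd], hd⟩
  · intro x i hi he
    by_cases hx : Good M x
    · obtain ⟨n0, a0, n1, a1, hd⟩ := Dat_exists hx
      have hsep := Mk_sep hd.2.2.1 hd.2.2.2.1 (by have := hd.1; have := hd.2.1; omega)
      have h0 := hmid x hx _ _ _ _ hd 0 0 hd.1 hd.2.1
      rw [el_one, act_one] at h0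
      rw [h0, hmid x hx _ _ _ _ hd i 0 hd.1 hd.2.1] at he
      have := (hs _ (by omega) _).2.2.1 _ (by have := hd.2.1; omega) he
      exact hi (sub_left_injective this)
    · rw [hc2 x hx, hc2 _ (fun h => hx ((good_act_iff _).mp h))] at he
      exact hw x i 0 hi he
  · intro x i hi hi' he
    by_cases hx : Good M x
    · obtain ⟨n0, a0, n1, a1, hd⟩ := Dat_exists hx
      have p0 := hd.1
      have p1 := hd.2.1
      have hsep := Mk_sep hd.2.2.1 hd.2.2.2.1 (by omega)
      obtain ⟨q1, q2, q3, q4⟩ := hs (n1 - n0).toNat (by omega) (sg k (n1 - n0) * a0 - a1)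
      have h0 := hmid x hx _ _ _ _ hd 0 0 hd.1 hd.2.1
      rw [el_one, act_one] at h0
      have hy : c (act (el i 1) x) = s (n1 - n0).toNat (sg k (n1 - n0) * a0 - a1)
          ((0 - n0).toNat + 1) (i - sg k (n0 - 1) * a0) := by
        have e : (0 - n0).toNat + 1 = (1 - n0).toNat := by omega
        rw [e]
        by_cases h1 : 1 < n1
        · exact hmid x hx _ _ _ _ hd i 1 (by omega) h1
        · have hn1 : n1 = 1 := by omega
          subst hn1
          rw [q2]
          obtain ⟨m0, b0, m1, b1, hd'⟩ := Dat_exists (hx.act (el i 1))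
          have hm : Mk M (act (el i 1) x) 0 (a1 - i) := by
            rw [Mk_act, sg_zero]; simpa using hd.2.2.2.1
          have hm0 : m0 = 0 := by
            by_contra hne
            exact hd'.2.2.2.2 0 _ (by have := hd'.1; omega) hd'.2.1 hm
          subst hm0
          have hb0 := Mk_unique hm hd'.2.2.1
          subst hb0
          have hsep' := Mk_sep hd'.2.2.1 hd'.2.2.2.1 hd'.2.1
          rw [hc1 _ (hx.act _) _ _ _ _ hd']
          simp only [val]
          have e0 : (-(0 : ℤ)).toNat = 0 := rfl
          rw [e0, (hs _ (by omega) _).1, sg_zero, sg_sub, sg_sub, sg_one]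
          congr 1
          ring
      rw [hy, h0] at he
      rcases q4 _ (by omega) _ _ he.symm with h | h
      · apply hi
        rw [sg_sub, sg_sub, sg_one, sg_zero] at h
        linear_combination h
      · apply hi'
        rw [sg_sub, sg_sub, sg_one, sg_zero] at h
        linear_combination h
    · rw [hc2 x hx, hc2 _ (fun h => hx ((good_act_iff _).mp h))] at he
      exact hw x i 1 hi he

theorem HasBaireColoring_mono {X : Type*} [TopologicalSpace X] {Adj : X → X → Prop} {n m : ℕ}
    (h : n ≤ m) (hc : HasBaireColoring Adj n) : HasBaireColoring Adj m := by
  obtain ⟨c, h1, h2⟩ := hc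
  refine ⟨fun x => Fin.castLE h (c x), fun i => ?_, fun x y hxy he => h2 x y hxy ?_⟩
  · have e : (fun x => Fin.castLE h (c x)) ⁻¹' {i} =
        ⋃ j : Fin n, ⋃ (_ : Fin.castLE h j = i), c ⁻¹' {j} := by
      ext x; simp
    rw [e]
    exact .iUnion fun j => .iUnion fun _ => h1 j
  · exact Fin.castLE_injective h he

end Markers

/-- For `k ≥ 3` there is no Baire measurable `k`-coloring of the shift
graph of `(Δ_k, T_k)`; the Baire measurable chromatic number of this shift graph equals
`k + 1`. -/
theorem baireChromatic_shift_DeltaK (k : ℕ) (hk : 3 ≤ k) :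
    ¬ HasBaireColoring (ShiftAdj (TK k)) k ∧
    baireChromatic (ShiftAdj (TK k)) = k + 1 := by
  refine ⟨no_baire_coloring hk, le_antisymm (Nat.sInf_le (has_baire_coloring hk)) ?_⟩
  refine le_csInf ⟨_, has_baire_coloring hk⟩ fun n hn => ?_
  by_contra hlt
  exact no_baire_coloring hk (HasBaireColoring_mono (by omega) hn)
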